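/- arXiv:1605.06389 — 2 statements merged into one kernel-verified Lean document; each statement's English description precedes it below -/
import Mathlib

section
/- (L^p-Poincaré type inequality) Let 1 ≤ N ≤ n be integers, 1 < p < ∞ with p ≠ N, let Ω ⊂ ℝⁿ be a bounded open set, and set R = sup_{x∈Ω} |x'|. Then for every complex-valued f ∈ C_0^∞(Ω \ {x' = 0}) one has (|N−p|/(Rp)) · (∫_Ω |f(x)|^p dx)^{1/p} ≤ (∫_Ω |∇f(x)|^p dx)^{1/p}. -/
open MeasureTheory

/-- The Euclidean norm of `x' = (x_1, …, x_N)`, the first `N` coordinates of `x ∈ ℝⁿ`. -/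
noncomputable def sliceNorm {n : ℕ} (N : ℕ) (h : N ≤ n) (x : EuclideanSpace ℝ (Fin n)) : ℝ :=
  Real.sqrt (∑ i : Fin N, (x (Fin.castLE h i)) ^ 2)

section Hardy

open scoped RealInnerProductSpace

variable {E : Type*} [NormedAddCommGroup E]

section Divergence

variable [NormedSpace ℝ E] [FiniteDimensional ℝ E] [MeasurableSpace E] [BorelSpace E]
  {μ : Measure E} [μ.IsAddHaarMeasure]

/-- Integration by parts against a linear functional. -/
theorem integral_clm_mul_fderiv_eq_neg (l : E →L[ℝ] ℝ) (v : E) {g : E → ℝ}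
    (hg : ContDiff ℝ 1 g) (hgc : HasCompactSupport g) :
    ∫ x, l x * fderiv ℝ g x v ∂μ = -(l v * ∫ x, g x ∂μ) := by
  have hg' : Continuous fun x => fderiv ℝ g x v :=
    (hg.continuous_fderiv one_ne_zero).clm_apply continuous_const
  have hgc' : HasCompactSupport fun x => fderiv ℝ g x v := hgc.fderiv_apply (𝕜 := ℝ) v
  have h := integral_mul_fderiv_eq_neg_fderiv_mul_of_integrable (μ := μ) (f := l) (g := g) (v := v)
    ?_ ?_ ?_ (fun x _ => l.differentiableAt) (fun x _ => hg.differentiable one_ne_zero x)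
  · rw [h]
    simp only [ContinuousLinearMap.fderiv]
    rw [integral_const_mul]
  · simp only [ContinuousLinearMap.fderiv]
    exact (hg.continuous.integrable_of_hasCompactSupport hgc).const_mul _
  · exact (l.continuous.mul hg').integrable_of_hasCompactSupport hgc'.mul_left
  · exact (l.continuous.mul hg.continuous).integrable_of_hasCompactSupport hgc.mul_left

end Divergence

variable [InnerProductSpace ℝ E] {ι : Type*} [Fintype ι]

theorem Orthonormal.norm_sum_inner_smul_sq {v : ι → E} (hv : Orthonormal ℝ v) (x : E) :
    ‖∑ i, ⟪v i, x⟫ • v i‖ ^ 2 = ∑ i, ⟪v i, x⟫ ^ 2 := by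
  rw [← real_inner_self_eq_norm_sq, hv.inner_sum]
  simp [pow_two]

theorem hasFDerivAt_sum_inner_sq (v : ι → E) (x : E) :
    HasFDerivAt (fun x => ∑ i, ⟪v i, x⟫ ^ 2) (∑ i, (2 * ⟪v i, x⟫) • innerSL ℝ (v i)) x := by
  refine HasFDerivAt.fun_sum fun i _ => ?_
  simpa using ((innerSL ℝ (v i)).hasFDerivAt (x := x)).pow 2

theorem contDiff_sum_inner_sq (v : ι → E) : ContDiff ℝ 1 fun x => ∑ i, ⟪v i, x⟫ ^ 2 :=
  ContDiff.sum fun i _ => ((innerSL ℝ (v i)).contDiff).pow 2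

variable {F : Type*} [NormedAddCommGroup F] [InnerProductSpace ℝ F]

/-- The product of a `C¹` function with a function that is `C¹` on its topological support. -/
theorem contDiff_mul_of_tsupport {G : Type*} [NormedAddCommGroup G] [NormedSpace ℝ G] {n : ℕ∞}
    {u w : G → ℝ} (hu : ContDiff ℝ n u)
    (hw : ∀ x ∈ tsupport u, ContDiffAt ℝ n w x) : ContDiff ℝ n fun x => u x * w x := by
  rw [contDiff_iff_contDiffAt]
  intro x
  by_cases hx : x ∈ tsupport u
  · exact hu.contDiffAt.mul (hw x hx)
  · refine (contDiffAt_const (c := (0 : ℝ))).congr_of_eventuallyEq ?_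
    filter_upwards [notMem_tsupport_iff_eventuallyEq.mp hx] with y hy
    simp [hy]

/-- Pointwise bound for the derivative of `‖f‖ ^ p / |Px| ^ p` along the field `x ↦ Px`, where `P`
is the orthogonal projection onto the span of `v`. -/
theorem abs_fderiv_hardy_le {v : ι → E} (hv : Orthonormal ℝ v) {p : ℝ} (hp : 1 < p)
    {f : E → F} (hf : Differentiable ℝ f) {x : E} (hx : 0 < ∑ i, ⟪v i, x⟫ ^ 2) :
    |fderiv ℝ (fun x => ‖f x‖ ^ p * (∑ i, ⟪v i, x⟫ ^ 2) ^ (-p / 2)) x (∑ i, ⟪v i, x⟫ • v i)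
        + p * (‖f x‖ ^ p * (∑ i, ⟪v i, x⟫ ^ 2) ^ (-p / 2))|
      ≤ p * ((‖f x‖ * (∑ i, ⟪v i, x⟫ ^ 2) ^ (-(1 : ℝ) / 2)) ^ (p - 1) * ‖fderiv ℝ f x‖) := by
  have hS := (hasFDerivAt_sum_inner_sq v x).rpow_const (p := -p / 2) (Or.inl hx.ne')
  have hh := ((hf.norm_rpow hp) x).hasFDerivAt
  rw [(hh.fun_mul hS).fderiv]
  have hP : (∑ i, (2 * ⟪v i, x⟫) • innerSL ℝ (v i)) (∑ i, ⟪v i, x⟫ • v i)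
      = 2 * ∑ i, ⟪v i, x⟫ ^ 2 := by
    rw [sum_apply, Finset.mul_sum]
    refine Finset.sum_congr rfl fun i _ => ?_
    rw [smul_apply, innerSL_apply_apply, hv.inner_right_fintype, smul_eq_mul]
    ring
  have hPn : ‖∑ i, ⟪v i, x⟫ • v i‖ = (∑ i, ⟪v i, x⟫ ^ 2) ^ ((1 : ℝ) / 2) := by
    rw [← hv.norm_sum_inner_smul_sq, ← Real.sqrt_eq_rpow, Real.sqrt_sq (norm_nonneg _)]
  have hb := norm_fderiv_norm_rpow_le hf (x := x) hp
  simp only [add_apply, smul_apply, smul_eq_mul, hP]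
  generalize hs : ∑ i, ⟪v i, x⟫ ^ 2 = s at *
  generalize ∑ i, ⟪v i, x⟫ • v i = y at *
  have e1 : s ^ (-p / 2 - 1) * s = s ^ (-p / 2) := by
    rw [← Real.rpow_add_one hx.ne']; ring_nf
  have e2 : ‖f x‖ ^ p * (-p / 2 * s ^ (-p / 2 - 1) * (2 * s))
      + s ^ (-p / 2) * fderiv ℝ (fun x => ‖f x‖ ^ p) x y + p * (‖f x‖ ^ p * s ^ (-p / 2))
      = s ^ (-p / 2) * fderiv ℝ (fun x => ‖f x‖ ^ p) x y := by
    linear_combination (-p * ‖f x‖ ^ p) * e1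
  rw [e2, abs_mul, abs_of_pos (Real.rpow_pos_of_pos hx _),
    Real.mul_rpow (norm_nonneg _) (by positivity), ← Real.rpow_mul hx.le]
  have e3 : s ^ (-p / 2) * s ^ ((1 : ℝ) / 2) = s ^ (-1 / 2 * (p - 1)) := by
    rw [← Real.rpow_add hx]; ring_nf
  calc s ^ (-p / 2) * |fderiv ℝ (fun x => ‖f x‖ ^ p) x y|
      ≤ s ^ (-p / 2) * (p * ‖f x‖ ^ (p - 1) * ‖fderiv ℝ f x‖ * s ^ ((1 : ℝ) / 2)) := by
        rw [← hPn]
        gcongr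
        exact ((fderiv ℝ (fun x => ‖f x‖ ^ p) x).le_opNorm y).trans (by gcongr)
    _ = _ := by rw [← e3]; ring

variable [FiniteDimensional ℝ E] [MeasurableSpace E] [BorelSpace E]
  {μ : Measure E} [μ.IsAddHaarMeasure]

/-- `L^p`-Hardy inequality with respect to the distance to the orthogonal complement of the span
of an orthonormal family. -/
theorem hardy_inequality {v : ι → E} (hv : Orthonormal ℝ v) {p : ℝ} (hp : 1 < p)
    {f : E → F} (hf : ContDiff ℝ 1 f) (hfc : HasCompactSupport f)
    (hfs : ∀ x ∈ tsupport f, 0 < ∑ i, ⟪v i, x⟫ ^ 2) :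
    Integrable (fun x => (‖f x‖ * (∑ i, ⟪v i, x⟫ ^ 2) ^ (-(1 : ℝ) / 2)) ^ p) μ ∧
      |(Fintype.card ι : ℝ) - p| / p *
        (∫ x, (‖f x‖ * (∑ i, ⟪v i, x⟫ ^ 2) ^ (-(1 : ℝ) / 2)) ^ p ∂μ) ^ (1 / p)
      ≤ (∫ x, ‖fderiv ℝ f x‖ ^ p ∂μ) ^ (1 / p) := by
  have hp0 : 0 < p := one_pos.trans hp
  have hSnn (x : E) : 0 ≤ ∑ i, ⟪v i, x⟫ ^ 2 := Finset.sum_nonneg fun i _ => sq_nonneg _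
  have hScd (q : ℝ) (x : E) (hx : x ∈ tsupport f) :
      ContDiffAt ℝ 1 (fun x => (∑ i, ⟪v i, x⟫ ^ 2) ^ q) x :=
    (contDiff_sum_inner_sq v).contDiffAt.rpow_const_of_ne (hfs x hx).ne'
  set A : E → ℝ := fun x => ‖f x‖ * (∑ i, ⟪v i, x⟫ ^ 2) ^ (-(1 : ℝ) / 2) with hA
  set K : E → ℝ := fun x => ‖f x‖ ^ p * (∑ i, ⟪v i, x⟫ ^ 2) ^ (-p / 2) with hK
  have hAK (x : E) : A x ^ p = K x := by
    simp only [hA, hK]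
    rw [Real.mul_rpow (norm_nonneg _) (Real.rpow_nonneg (hSnn x) _), ← Real.rpow_mul (hSnn x)]
    ring_nf
  have hAnn (x : E) : 0 ≤ A x := mul_nonneg (norm_nonneg _) (Real.rpow_nonneg (hSnn x) _)
  have hts : tsupport (fun x => ‖f x‖ ^ p) ⊆ tsupport f := by
    refine closure_mono fun x hx => ?_
    contrapose! hx
    simp [Function.notMem_support.mp hx, hp0.ne']
  have hKcd : ContDiff ℝ 1 K :=
    contDiff_mul_of_tsupport (n := 1) (hf.norm_rpow hp) fun x hx => hScd _ x (hts hx)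
  have hKc : HasCompactSupport K := (hfc.mono' (subset_closure.trans hts)).mul_right
  have hAc : HasCompactSupport A := hfc.norm.mul_right
  have hAcont : Continuous A := by
    rw [continuous_iff_continuousAt]
    intro x
    by_cases hx : x ∈ tsupport f
    · exact hf.continuous.norm.continuousAt.mul (hScd _ x hx).continuousAt
    · refine (continuousAt_const (y := (0 : ℝ))).congr ?_
      filter_upwards [notMem_tsupport_iff_eventuallyEq.mp hx] with y hy
      simp [hA, hy]
  have hBcont : Continuous fun x => ‖fderiv ℝ f x‖ := (hf.continuous_fderiv one_ne_zero).norm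
  have hBc : HasCompactSupport fun x => ‖fderiv ℝ f x‖ := (hfc.fderiv ℝ).norm
  have hK'c (w : E) : Continuous fun x => fderiv ℝ K x w :=
    (hKcd.continuous_fderiv one_ne_zero).clm_apply continuous_const
  have hint (i : ι) : Integrable (fun x => ⟪v i, x⟫ * fderiv ℝ K x (v i)) μ :=
    ((innerSL ℝ (v i)).continuous.mul (hK'c _)).integrable_of_hasCompactSupport
      (hKc.fderiv_apply (𝕜 := ℝ) (v i)).mul_left
  have hdiv : ∫ x, fderiv ℝ K x (∑ i, ⟪v i, x⟫ • v i) ∂μ = -(Fintype.card ι * ∫ x, K x ∂μ) := by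
    simp only [map_sum, map_smul, smul_eq_mul]
    rw [integral_finsetSum _ fun i _ => hint i]
    have (i : ι) : ∫ x, ⟪v i, x⟫ * fderiv ℝ K x (v i) ∂μ = -∫ x, K x ∂μ := by
      have := integral_clm_mul_fderiv_eq_neg (μ := μ) (innerSL ℝ (v i)) (v i) hKcd hKc
      simpa [hv.1 i] using this
    simp [this]
  have hKint : Integrable K μ := hKcd.continuous.integrable_of_hasCompactSupport hKc
  have hDint : Integrable (fun x => fderiv ℝ K x (∑ i, ⟪v i, x⟫ • v i)) μ := by
    simp only [map_sum, map_smul, smul_eq_mul]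
    exact integrable_finsetSum _ fun i _ => hint i
  have hpt (x : E) : |fderiv ℝ K x (∑ i, ⟪v i, x⟫ • v i) + p * K x|
      ≤ p * (A x ^ (p - 1) * ‖fderiv ℝ f x‖) := by
    by_cases hx : x ∈ tsupport f
    · exact abs_fderiv_hardy_le hv hp (hf.differentiable one_ne_zero) (hfs x hx)
    · have hK0 : K =ᶠ[nhds x] fun _ => 0 := by
        filter_upwards [notMem_tsupport_iff_eventuallyEq.mp hx] with y hy
        simp [hK, hy, hp0.ne']
      rw [hK0.fderiv_eq, hK0.eq_of_nhds]
      have := hAnn x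
      simp only [fderiv_fun_const, Pi.zero_apply, zero_apply, mul_zero,
        add_zero, abs_zero]
      positivity
  have hA1cont : Continuous fun x => A x ^ (p - 1) :=
    hAcont.rpow_const fun x => Or.inr (by linarith)
  have hA1c : HasCompactSupport fun x => A x ^ (p - 1) := by
    refine hAc.comp_left (g := fun t : ℝ => t ^ (p - 1)) ?_
    exact Real.zero_rpow (by linarith)
  have hmain : |(Fintype.card ι : ℝ) - p| * ∫ x, K x ∂μ
      ≤ p * ∫ x, A x ^ (p - 1) * ‖fderiv ℝ f x‖ ∂μ := by
    have hKnn : 0 ≤ ∫ x, K x ∂μ :=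
      integral_nonneg fun x => by rw [← hAK]; exact Real.rpow_nonneg (hAnn x) _
    have e : ∫ x, (fderiv ℝ K x (∑ i, ⟪v i, x⟫ • v i) + p * K x) ∂μ
        = -(((Fintype.card ι : ℝ) - p) * ∫ x, K x ∂μ) := by
      rw [integral_add hDint (hKint.const_mul p), hdiv, integral_const_mul]
      ring
    rw [← abs_of_nonneg hKnn, ← abs_mul, ← abs_neg, ← e, ← integral_const_mul]
    refine abs_integral_le_integral_abs.trans (integral_mono (hDint.add (hKint.const_mul p)).abs
      ?_ hpt)
    exact ((hA1cont.mul hBcont).integrable_of_hasCompactSupport hA1c.mul_right).const_mul _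
  have hq : p.HolderConjugate (p / (p - 1)) := Real.HolderConjugate.conjExponent hp
  have hholder := integral_mul_le_Lp_mul_Lq_of_nonneg (μ := μ) hq.symm
    (f := fun x => A x ^ (p - 1)) (g := fun x => ‖fderiv ℝ f x‖)
    (.of_forall fun x => Real.rpow_nonneg (hAnn x) _) (.of_forall fun x => norm_nonneg _)
    (hA1cont.memLp_of_hasCompactSupport hA1c) (hBcont.memLp_of_hasCompactSupport hBc)
  have hApow (x : E) : (A x ^ (p - 1)) ^ (p / (p - 1)) = A x ^ p := by
    rw [← Real.rpow_mul (hAnn x), mul_div_cancel₀ _ (by linarith : p - 1 ≠ 0)]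
  simp only [hApow] at hholder
  simp only [← hAK] at hmain
  set G := ∫ x, A x ^ p ∂μ with hG
  have hGnn : 0 ≤ G := integral_nonneg fun x => Real.rpow_nonneg (hAnn x) _
  refine ⟨hKint.congr (.of_forall fun x => (hAK x).symm), ?_⟩
  rcases hGnn.eq_or_lt with hG0 | hGpos
  · rw [← hG0, Real.zero_rpow (by positivity), mul_zero]
    positivity
  · have hsplit : G ^ (1 / (p / (p - 1))) * G ^ (1 / p) = G := by
      rw [← Real.rpow_add hGpos]
      have : 1 / (p / (p - 1)) + 1 / p = 1 := by
        have : p - 1 ≠ 0 := by linarith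
        field_simp
        ring
      rw [this, Real.rpow_one]
    have hc : 0 < G ^ (1 / (p / (p - 1))) := Real.rpow_pos_of_pos hGpos _
    rw [div_mul_eq_mul_div, div_le_iff₀ hp0]
    refine le_of_mul_le_mul_left ?_ hc
    calc G ^ (1 / (p / (p - 1))) * (|(Fintype.card ι : ℝ) - p| * G ^ (1 / p))
        = |(Fintype.card ι : ℝ) - p| * G := by
          conv_rhs => rw [← hsplit]
          ring
      _ ≤ p * ∫ x, A x ^ (p - 1) * ‖fderiv ℝ f x‖ ∂μ := hmain
      _ ≤ p * (G ^ (1 / (p / (p - 1))) * (∫ x, ‖fderiv ℝ f x‖ ^ p ∂μ) ^ (1 / p)) := by gcongr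
      _ = _ := by ring

end Hardy

theorem sliceNorm_le_norm {n N : ℕ} (h : N ≤ n) (x : EuclideanSpace ℝ (Fin n)) :
    sliceNorm N h x ≤ ‖x‖ := by
  rw [sliceNorm, EuclideanSpace.norm_eq]
  refine Real.sqrt_le_sqrt ?_
  simp only [Real.norm_eq_abs, sq_abs]
  exact (Finset.sum_map Finset.univ (Fin.castLEEmb h) fun i => x i ^ 2).symm.trans_le
    (Finset.sum_le_univ_sum_of_nonneg fun i => sq_nonneg _)

/-- `L^p`-Poincaré type inequality on a bounded open set `Ω ⊂ ℝⁿ = ℝ^N × ℝ^{n-N}`. -/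
theorem stmt12 (n N : ℕ) (hN : 1 ≤ N) (hNn : N ≤ n) (p : ℝ) (hp1 : 1 < p) (hpN : p ≠ N)
    (Ω : Set (EuclideanSpace ℝ (Fin n))) (hΩo : IsOpen Ω) (hΩb : Bornology.IsBounded Ω)
    (R : ℝ) (hR : R = sSup ((fun x => sliceNorm N hNn x) '' Ω))
    (f : EuclideanSpace ℝ (Fin n) → ℂ) (hf : ContDiff ℝ (⊤ : ℕ∞) f)
    (hfc : HasCompactSupport f)
    (hfs : tsupport f ⊆ Ω ∩ {x | ∃ i : Fin N, x (Fin.castLE hNn i) ≠ 0}) :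
    (|(N : ℝ) - p| / (R * p)) * (∫ x in Ω, ‖f x‖ ^ p) ^ (1 / p)
      ≤ (∫ x in Ω, ‖fderiv ℝ f x‖ ^ p) ^ (1 / p) := by
  have hp0 : 0 < p := one_pos.trans hp1
  have hf1 : ContDiff ℝ 1 f := hf.of_le (by exact_mod_cast le_top)
  have hsn (x : EuclideanSpace ℝ (Fin n)) : 0 ≤ sliceNorm N hNn x := Real.sqrt_nonneg _
  have hR0 : 0 ≤ R := by
    rw [hR]
    exact Real.sSup_nonneg (by rintro _ ⟨x, -, rfl⟩; exact hsn x)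
  have hle : ∀ x ∈ Ω, sliceNorm N hNn x ≤ R := by
    intro x hx
    rw [hR]
    obtain ⟨C, hC⟩ := hΩb.exists_norm_le
    refine le_csSup ⟨C, ?_⟩ ⟨x, hx, rfl⟩
    rintro _ ⟨y, hy, rfl⟩
    exact (sliceNorm_le_norm hNn y).trans (hC y hy)
  rcases hR0.eq_or_lt with hR00 | hRpos
  · rw [← hR00, zero_mul, div_zero, zero_mul]
    positivity
  let v : Fin N → EuclideanSpace ℝ (Fin n) := fun i => EuclideanSpace.single (Fin.castLE hNn i) 1
  have hv : Orthonormal ℝ v := by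
    have := (EuclideanSpace.basisFun (Fin n) ℝ).orthonormal.comp _ (Fin.castLE_injective hNn)
    convert! this using 1
    ext i
    simp [v]
  have hvx (x : EuclideanSpace ℝ (Fin n)) (i : Fin N) :
      inner ℝ (v i) x = x (Fin.castLE hNn i) := by
    simp [v, EuclideanSpace.inner_single_left]
  have hS (x : EuclideanSpace ℝ (Fin n)) (hx : x ∈ tsupport f) :
      0 < ∑ i, x (Fin.castLE hNn i) ^ 2 := by
    obtain ⟨i, hi⟩ := (hfs hx).2
    exact Finset.sum_pos' (fun i _ => sq_nonneg _) ⟨i, Finset.mem_univ _, by positivity⟩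
  obtain ⟨hi, hH⟩ := hardy_inequality (μ := volume) hv hp1 hf1 hfc (by simpa only [hvx] using hS)
  simp only [hvx, Fintype.card_fin] at hi hH
  have hsuppf : tsupport f ⊆ Ω := fun x hx => (hfs hx).1
  have hΩf : ∫ x in Ω, ‖f x‖ ^ p = ∫ x, ‖f x‖ ^ p := by
    refine setIntegral_eq_integral_of_forall_compl_eq_zero fun x hx => ?_
    simp [image_eq_zero_of_notMem_tsupport (mt (@hsuppf x) hx), hp0.ne']
  have hΩf' : ∫ x in Ω, ‖fderiv ℝ f x‖ ^ p = ∫ x, ‖fderiv ℝ f x‖ ^ p := by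
    refine setIntegral_eq_integral_of_forall_compl_eq_zero fun x hx => ?_
    have : fderiv ℝ f x = 0 := image_eq_zero_of_notMem_tsupport
      (mt (fun h => hsuppf (tsupport_fderiv_subset ℝ h)) hx)
    simp [this, hp0.ne']
  rw [hΩf, hΩf']
  refine le_trans ?_ hH
  have hpt (x : EuclideanSpace ℝ (Fin n)) : ‖f x‖ ^ p ≤
      R ^ p * (‖f x‖ * (∑ i, x (Fin.castLE hNn i) ^ 2) ^ (-(1 : ℝ) / 2)) ^ p := by
    by_cases hx : x ∈ tsupport f
    · have hSx := hS x hx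
      have hRx := hle x (hsuppf hx)
      rw [sliceNorm, Real.sqrt_eq_rpow] at hRx
      rw [← Real.mul_rpow hRpos.le (by positivity)]
      refine Real.rpow_le_rpow (norm_nonneg _) ?_ hp0.le
      have h1 : (∑ i, x (Fin.castLE hNn i) ^ 2) ^ ((1 : ℝ) / 2)
          * (∑ i, x (Fin.castLE hNn i) ^ 2) ^ (-(1 : ℝ) / 2) = 1 := by
        rw [← Real.rpow_add hSx]
        norm_num
      calc ‖f x‖ = ‖f x‖ * ((∑ i, x (Fin.castLE hNn i) ^ 2) ^ ((1 : ℝ) / 2)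
          * (∑ i, x (Fin.castLE hNn i) ^ 2) ^ (-(1 : ℝ) / 2)) := by rw [h1, mul_one]
        _ ≤ ‖f x‖ * (R * (∑ i, x (Fin.castLE hNn i) ^ 2) ^ (-(1 : ℝ) / 2)) := by gcongr
        _ = _ := by ring
    · simp [image_eq_zero_of_notMem_tsupport hx, hp0.ne']
  have hint := integral_mono_of_nonneg
    (.of_forall fun x => Real.rpow_nonneg (norm_nonneg (f x)) p) (hi.const_mul (R ^ p))
    (.of_forall hpt)
  rw [integral_const_mul] at hint
  have hroot := Real.rpow_le_rpow (z := 1 / p) (integral_nonneg fun x => by positivity) hint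
    (by positivity)
  rw [Real.mul_rpow (by positivity) (integral_nonneg fun x => by positivity),
    ← Real.rpow_mul hRpos.le, mul_one_div_cancel hp0.ne', Real.rpow_one] at hroot
  refine (mul_le_mul_of_nonneg_left hroot (by positivity)).trans_eq ?_
  field_simp
end

section
/- (Hardy–Rellich type inequality for the p-Laplacian) Let n ≥ 2, 1 < p < n, let q satisfy 1/p + 1/q = 1, and let α, β ∈ ℝ be such that (p−n)/(p−1) ≤ γ := α + β + 1 ≤ 0. Let f ∈ C_0^∞(ℝⁿ \ {0}) be real-valued and assume the vector field x ↦ |∇f(x)|^{p−2} ∇f(x) is continuously differentiable, so that Δ_p f = div(|∇f|^{p−2}∇f) is defined. Then ((n + γ(p−1) − p)/p) ∫_{ℝⁿ} |∇f(x)|^p / ‖x‖^γ dx ≤ (∫_{ℝⁿ} |Δ_p f(x)|^p / ‖x‖^{αp} dx)^{1/p} · (∫_{ℝⁿ} |∇f(x)|^q / ‖x‖^{βq} dx)^{1/q}. -/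
open MeasureTheory

/-- Divergence of a vector field on `ℝⁿ`, given by the sum of coordinate partial derivatives. -/
noncomputable def vdiv {n : ℕ} (V : EuclideanSpace ℝ (Fin n) → EuclideanSpace ℝ (Fin n))
    (x : EuclideanSpace ℝ (Fin n)) : ℝ :=
  ∑ i, fderiv ℝ V x (EuclideanSpace.single i 1) i

/-- The vector field `|∇f|^{p-2} ∇f` associated to the `p`-Laplacian. -/
noncomputable def pLapField {n : ℕ} (p : ℝ) (f : EuclideanSpace ℝ (Fin n) → ℝ)
    (x : EuclideanSpace ℝ (Fin n)) : EuclideanSpace ℝ (Fin n) :=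
  ‖gradient f x‖ ^ (p - 2) • gradient f x

/-- The `p`-Laplacian `Δ_p f = div(|∇f|^{p-2}∇f)`. -/
noncomputable def pLaplacian {n : ℕ} (p : ℝ) (f : EuclideanSpace ℝ (Fin n) → ℝ)
    (x : EuclideanSpace ℝ (Fin n)) : ℝ :=
  vdiv (pLapField p f) x

open scoped RealInnerProductSpace

section Calculus

variable {E F : Type*} [NormedAddCommGroup E] [InnerProductSpace ℝ E]
  [NormedAddCommGroup F] [NormedSpace ℝ F]

theorem hasFDerivAt_norm_rpow_of_ne_zero {x : E} (hx : x ≠ 0) (s : ℝ) :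
    HasFDerivAt (fun y : E ↦ ‖y‖ ^ s) ((s * ‖x‖ ^ (s - 2)) • innerSL ℝ x) x := by
  have h := (hasStrictFDerivAt_norm_sq x).hasFDerivAt.rpow_const (p := s / 2)
    (Or.inl (by simpa using hx))
  have key : ∀ (y : E) (t : ℝ), (‖y‖ ^ 2) ^ (t / 2) = ‖y‖ ^ t := fun y t ↦ by
    rw [← Real.rpow_natCast, ← Real.rpow_mul (norm_nonneg y)]
    congr 1
    push_cast
    ring
  simp only [key] at h
  convert h using 1
  rw [show s / 2 - 1 = (s - 2) / 2 by ring, key, ← Nat.cast_smul_eq_nsmul ℝ, smul_smul]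
  congr 1
  push_cast
  ring

theorem contDiffAt_norm_rpow_of_ne_zero {x : E} (hx : x ≠ 0) (s : ℝ) {k : WithTop ℕ∞} :
    ContDiffAt ℝ k (fun y : E ↦ ‖y‖ ^ s) x :=
  (contDiffAt_norm ℝ hx).rpow_const_of_ne (norm_ne_zero_iff.2 hx)

theorem contDiff_of_eq_zero_off {K : Set E} (hK : IsClosed K) {k : WithTop ℕ∞} {g : E → F}
    (h₀ : ∀ x ∉ K, g x = 0) (h : ∀ x ∈ K, ContDiffAt ℝ k g x) : ContDiff ℝ k g := by
  refine contDiff_iff_contDiffAt.2 fun x ↦ ?_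
  by_cases hx : x ∈ K
  · exact h x hx
  · refine (contDiffAt_const (c := (0 : F))).congr_of_eventuallyEq ?_
    filter_upwards [hK.isOpen_compl.mem_nhds hx] with y hy using h₀ y hy

theorem continuous_of_eq_zero_off {X Y : Type*} [TopologicalSpace X] [TopologicalSpace Y] [Zero Y]
    {K : Set X} (hK : IsClosed K) {g : X → Y}
    (h₀ : ∀ x ∉ K, g x = 0) (h : ∀ x ∈ K, ContinuousAt g x) : Continuous g := by
  refine continuous_iff_continuousAt.2 fun x ↦ ?_
  by_cases hx : x ∈ K
  · exact h x hx
  · refine (continuousAt_const (y := (0 : Y))).congr ?_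
    filter_upwards [hK.isOpen_compl.mem_nhds hx] with y hy using (h₀ y hy).symm

theorem gradient_eq_zero_of_notMem_tsupport [CompleteSpace E] {f : E → ℝ} {x : E}
    (hx : x ∉ tsupport f) : gradient f x = 0 := by
  have : fderiv ℝ f x = 0 := by
    by_contra h
    exact hx (support_fderiv_subset ℝ h)
  simp [gradient, this]

theorem ContDiff.gradient_one [CompleteSpace E] {f : E → ℝ} (hf : ContDiff ℝ 2 f) :
    ContDiff ℝ 1 (gradient f) :=
  (InnerProductSpace.toDual ℝ E).symm.contDiff.comp (hf.fderiv_right (by norm_num))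

theorem ContDiff.inner_fderiv_gradient [CompleteSpace E] {f : E → ℝ} (hf : ContDiff ℝ 2 f)
    (x a b : E) : ⟪fderiv ℝ (gradient f) x a, b⟫ = fderiv ℝ (fderiv ℝ f) x a b := by
  have hd : DifferentiableAt ℝ (fderiv ℝ f) x :=
    (hf.fderiv_right (m := 1) (by norm_num)).differentiable (by norm_num) x
  have h : HasFDerivAt (gradient f) _ x :=
    (InnerProductSpace.toDual ℝ E).symm.toContinuousLinearEquiv.hasFDerivAt.comp x hd.hasFDerivAt
  rw [h.fderiv]
  simp

theorem ContDiff.inner_fderiv_gradient_symm [CompleteSpace E] {f : E → ℝ} (hf : ContDiff ℝ 2 f)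
    (x a b : E) :
    ⟪fderiv ℝ (gradient f) x a, b⟫ = ⟪fderiv ℝ (gradient f) x b, a⟫ := by
  rw [hf.inner_fderiv_gradient, hf.inner_fderiv_gradient]
  exact hf.contDiffAt.isSymmSndFDerivAt (by simp) a b

end Calculus

section Divergence

variable {n : ℕ}

local notation "𝔼" => EuclideanSpace ℝ (Fin n)

theorem sum_clm_single_mul (L : 𝔼 →L[ℝ] ℝ) (v : 𝔼) :
    ∑ i, L (EuclideanSpace.single i 1) * v i = L v := by
  conv_rhs => rw [← (EuclideanSpace.basisFun (Fin n) ℝ).sum_repr v, map_sum]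
  simp [mul_comm]

theorem vdiv_sub {V W : 𝔼 → 𝔼} {x : 𝔼} (hV : DifferentiableAt ℝ V x)
    (hW : DifferentiableAt ℝ W x) :
    vdiv (fun y ↦ V y - W y) x = vdiv V x - vdiv W x := by
  simp [vdiv, fderiv_fun_sub hV hW, Finset.sum_sub_distrib]

theorem vdiv_smul {φ : 𝔼 → ℝ} {V : 𝔼 → 𝔼} {φ' : 𝔼 →L[ℝ] ℝ} {x : 𝔼}
    (hφ : HasFDerivAt φ φ' x) (hV : DifferentiableAt ℝ V x) :
    vdiv (fun y ↦ φ y • V y) x = φ x * vdiv V x + φ' (V x) := by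
  rw [← sum_clm_single_mul φ' (V x)]
  have h : fderiv ℝ (fun y ↦ φ y • V y) x = _ := (hφ.smul hV.hasFDerivAt).fderiv
  simp [vdiv, h, Finset.sum_add_distrib, Finset.mul_sum]

theorem vdiv_id (x : 𝔼) : vdiv (fun y ↦ y) x = n := by
  simp [vdiv]

theorem continuous_vdiv {V : 𝔼 → 𝔼} (hV : ContDiff ℝ 1 V) : Continuous (vdiv V) := by
  have := hV.continuous_fderiv (by norm_num)
  unfold vdiv
  fun_prop

theorem vdiv_eq_zero_of_eq_zero_off {K : Set 𝔼} (hK : IsClosed K) {V : 𝔼 → 𝔼}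
    (h₀ : ∀ x ∉ K, V x = 0) {x : 𝔼} (hx : x ∉ K) : vdiv V x = 0 := by
  have h : V =ᶠ[nhds x] fun _ ↦ 0 := by
    filter_upwards [hK.isOpen_compl.mem_nhds hx] with y hy using h₀ y hy
  simp [vdiv, h.fderiv_eq]

theorem integral_vdiv_eq_zero {V : 𝔼 → 𝔼} (hV : ContDiff ℝ 1 V) (hc : HasCompactSupport V) :
    ∫ x, vdiv V x = 0 := by
  have hcf := hV.continuous_fderiv (by norm_num)
  have hint : ∀ i : Fin n, Integrable
      (fun x ↦ fderiv ℝ V x (EuclideanSpace.single i 1) i) := fun i ↦ by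
    refine Continuous.integrable_of_hasCompactSupport (by fun_prop) ?_
    exact (hc.fderiv ℝ).comp_left (g := fun L : 𝔼 →L[ℝ] 𝔼 ↦ L (EuclideanSpace.single i 1) i)
      (by simp)
  unfold vdiv
  rw [integral_finsetSum _ fun i _ ↦ hint i]
  refine Finset.sum_eq_zero fun i _ ↦ ?_
  have hcomp : ∀ x, fderiv ℝ (fun y ↦ V y i) x (EuclideanSpace.single i 1) =
      fderiv ℝ V x (EuclideanSpace.single i 1) i := fun x ↦ by
    have h := (EuclideanSpace.proj (𝕜 := ℝ) i).hasFDerivAt.comp x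
      (hV.differentiable (by norm_num) x).hasFDerivAt
    have h' : fderiv ℝ (fun y ↦ V y i) x = _ := h.fderiv
    rw [h']
    simp
  have hVi : ContDiff ℝ 1 fun y ↦ V y i := by fun_prop
  have h := integral_mul_fderiv_eq_neg_fderiv_mul_of_integrable (μ := (volume : Measure 𝔼))
    (𝕜 := ℝ) (f := fun _ ↦ 1) (g := fun y ↦ V y i) (v := EuclideanSpace.single i 1)
    (by simp) (by simpa only [hcomp, one_mul] using hint i)
    (by
      simp only [one_mul]
      exact hVi.continuous.integrable_of_hasCompactSupport
        (hc.comp_left (g := fun v : 𝔼 ↦ v i) (by simp)))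
    (fun x _ ↦ by fun_prop) (fun x _ ↦ hVi.differentiable (by norm_num) x)
  simpa [hcomp] using h

end Divergence

theorem Real.rpow_eq_rpow_sub_two_mul_sq {t : ℝ} (ht : 0 ≤ t) {p : ℝ} (hp : p ≠ 0) :
    t ^ p = t ^ (p - 2) * t ^ 2 := by
  rcases ht.eq_or_lt with rfl | h
  · simp [Real.zero_rpow hp]
  · rw [← Real.rpow_natCast, ← Real.rpow_add h]
    congr 1
    push_cast
    ring

section PLaplace

variable {n : ℕ}

local notation "𝔼" => EuclideanSpace ℝ (Fin n)

/-- The Rellich–Pohozaev vector field `‖x‖^{-γ} (⟪x, ∇f⟫ |∇f|^{p-2}∇f - (|∇f|^p / p) x)`. -/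
noncomputable def pohozaevField (p γ : ℝ) (f : 𝔼 → ℝ) (x : 𝔼) : 𝔼 :=
  (⟪x, gradient f x⟫ * ‖x‖ ^ (-γ)) • pLapField p f x -
    (p⁻¹ * (‖gradient f x‖ ^ p * ‖x‖ ^ (-γ))) • x

theorem vdiv_pohozaevField {p γ : ℝ} (hp : 1 < p) {f : 𝔼 → ℝ} (hf : ContDiff ℝ 2 f) {x : 𝔼}
    (hV : DifferentiableAt ℝ (pLapField p f) x) (hx : x ≠ 0) :
    vdiv (pohozaevField p γ f) x =
      ‖x‖ ^ (-γ) * ⟪x, gradient f x⟫ * pLaplacian p f x -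
      (n - γ - p) / p * (‖gradient f x‖ ^ p * ‖x‖ ^ (-γ)) -
      γ * (‖x‖ ^ (-γ - 2) * ‖gradient f x‖ ^ (p - 2) * ⟪x, gradient f x⟫ ^ 2) := by
  have hu := (hf.gradient_one.differentiable (by norm_num) x).hasFDerivAt
  have hw := hasFDerivAt_norm_rpow_of_ne_zero hx (-γ)
  have hφ := ((hasFDerivAt_id x).inner ℝ hu).mul hw
  have hψ := (((hasFDerivAt_norm_rpow (gradient f x) hp).comp x hu).mul hw).const_mul p⁻¹
  have h₁ := vdiv_smul hφ hV
  have h₂ := vdiv_smul hψ (differentiableAt_id (x := x))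
  have h₃ := vdiv_sub (hφ.differentiableAt.smul hV)
    (hψ.differentiableAt.smul (differentiableAt_id (x := x)))
  have h₄ : vdiv (pohozaevField p γ f) x = _ := h₃
  have hid : vdiv (id : 𝔼 → 𝔼) x = n := vdiv_id x
  rw [h₄]
  refine (congrArg₂ (· - ·) h₁ h₂).trans ?_
  have hsymm := hf.inner_fderiv_gradient_symm x (gradient f x) x
  rw [real_inner_comm] at hsymm
  have hp0 : p ≠ 0 := by positivity
  have e₁ := Real.rpow_eq_rpow_sub_two_mul_sq (norm_nonneg (gradient f x)) hp0
  have e₂ : ‖x‖ ^ (-γ) = ‖x‖ ^ (-γ - 2) * ‖x‖ ^ 2 := by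
    rw [← Real.rpow_natCast, ← Real.rpow_add (norm_pos_iff.2 hx)]
    congr 1
    push_cast
    ring
  simp [pLaplacian, hid, pLapField, hsymm, e₁, e₂]
  field_simp
  ring

end PLaplace

/-- Hardy–Rellich type inequality for the `p`-Laplacian on `ℝⁿ`. -/
theorem stmt13 (n : ℕ) (hn : 2 ≤ n) (p q α β γ : ℝ) (hp1 : 1 < p) (hpn : p < n)
    (hq : 1 / p + 1 / q = 1) (hγ : γ = α + β + 1)
    (hγl : (p - n) / (p - 1) ≤ γ) (hγu : γ ≤ 0)
    (f : EuclideanSpace ℝ (Fin n) → ℝ) (hf : ContDiff ℝ (⊤ : ℕ∞) f)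
    (hfc : HasCompactSupport f) (hfs : tsupport f ⊆ {(0 : EuclideanSpace ℝ (Fin n))}ᶜ)
    (hV : ContDiff ℝ 1 (pLapField p f)) :
    (((n : ℝ) + γ * (p - 1) - p) / p) * ∫ x, ‖gradient f x‖ ^ p / ‖x‖ ^ γ
      ≤ (∫ x, |pLaplacian p f x| ^ p / ‖x‖ ^ (α * p)) ^ (1 / p) *
        (∫ x, ‖gradient f x‖ ^ q / ‖x‖ ^ (β * q)) ^ (1 / q) := by
  have hp0 : 0 < p := by linarith
  have hf2 : ContDiff ℝ 2 f := hf.of_le (WithTop.coe_le_coe.2 le_top)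
  have hS : IsClosed (tsupport f) := isClosed_tsupport f
  have hne : ∀ x ∈ tsupport f, x ≠ 0 := fun x hx ↦ hfs hx
  have hu0 : ∀ x ∉ tsupport f, gradient f x = 0 := fun x ↦ gradient_eq_zero_of_notMem_tsupport
  have hV0 : ∀ x ∉ tsupport f, pLapField p f x = 0 := fun x hx ↦ by simp [pLapField, hu0 x hx]
  have hD0 : ∀ x ∉ tsupport f, pLaplacian p f x = 0 := fun x hx ↦
    vdiv_eq_zero_of_eq_zero_off hS hV0 hx
  have hu := hf2.gradient_one
  have huc := hu.continuous
  have hDc : Continuous (pLaplacian p f) := continuous_vdiv hV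
  have hw : ∀ x ∈ tsupport f, ∀ s : ℝ,
      ContinuousAt (fun y : EuclideanSpace ℝ (Fin n) ↦ ‖y‖ ^ s) x :=
    fun x hx s ↦ (hasFDerivAt_norm_rpow_of_ne_zero (hne x hx) s).continuousAt
  have hwne : ∀ x ∈ tsupport f, ∀ s : ℝ, ‖x‖ ^ s ≠ 0 := fun x hx s ↦
    (Real.rpow_pos_of_pos (norm_pos_iff.2 (hne x hx)) s).ne'
  have hcs : ∀ {G : Type} [NormedAddCommGroup G] {g : EuclideanSpace ℝ (Fin n) → G},
      (∀ x ∉ tsupport f, g x = 0) → HasCompactSupport g := fun h ↦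
    HasCompactSupport.intro hfc fun x hx ↦ h x hx
  -- the divergence theorem for the Pohozaev field
  have hP0 : ∀ x ∉ tsupport f, pohozaevField p γ f x = 0 := fun x hx ↦ by
    simp [pohozaevField, hu0 x hx, hV0 x hx, Real.zero_rpow hp0.ne']
  have hP : ContDiff ℝ 1 (pohozaevField p γ f) := by
    refine contDiff_of_eq_zero_off hS hP0 fun x hx ↦ ?_
    have h₁ := contDiffAt_norm_rpow_of_ne_zero (hne x hx) (-γ) (k := 1)
    have h₂ := (hu.norm_rpow hp1).contDiffAt (x := x)
    exact (((contDiffAt_id.inner ℝ hu.contDiffAt).mul h₁).smul hV.contDiffAt).sub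
      ((contDiffAt_const.mul (h₂.mul h₁)).smul contDiffAt_id)
  have hPint := integral_vdiv_eq_zero hP (hcs hP0)
  -- the two factors of the Hölder inequality
  set F : EuclideanSpace ℝ (Fin n) → ℝ := fun x ↦ |pLaplacian p f x| / ‖x‖ ^ α with hF
  set G : EuclideanSpace ℝ (Fin n) → ℝ := fun x ↦ ‖gradient f x‖ / ‖x‖ ^ β with hG
  have hF0 : ∀ x ∉ tsupport f, F x = 0 := fun x hx ↦ by simp [hF, hD0 x hx]
  have hG0 : ∀ x ∉ tsupport f, G x = 0 := fun x hx ↦ by simp [hG, hu0 x hx]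
  have hFc : Continuous F := continuous_of_eq_zero_off hS hF0 fun x hx ↦
    hDc.abs.continuousAt.div (hw x hx α) (hwne x hx α)
  have hGc : Continuous G := continuous_of_eq_zero_off hS hG0 fun x hx ↦
    huc.norm.continuousAt.div (hw x hx β) (hwne x hx β)
  have hFn : ∀ x, 0 ≤ F x := fun x ↦ by positivity
  have hGn : ∀ x, 0 ≤ G x := fun x ↦ by positivity
  have hpq : p.HolderConjugate q := by
    rw [Real.holderConjugate_iff]
    exact ⟨hp1, by simpa using hq⟩
  have holder := integral_mul_le_Lp_mul_Lq_of_nonneg (μ := volume) hpq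
    (Filter.Eventually.of_forall hFn) (Filter.Eventually.of_forall hGn)
    (hFc.memLp_of_hasCompactSupport (hcs hF0)) (hGc.memLp_of_hasCompactSupport (hcs hG0))
  have hFp : ∀ x, F x ^ p = |pLaplacian p f x| ^ p / ‖x‖ ^ (α * p) := fun x ↦ by
    rw [hF, Real.div_rpow (abs_nonneg _) (by positivity), ← Real.rpow_mul (norm_nonneg x)]
  have hGq : ∀ x, G x ^ q = ‖gradient f x‖ ^ q / ‖x‖ ^ (β * q) := fun x ↦ by
    rw [hG, Real.div_rpow (norm_nonneg _) (by positivity), ← Real.rpow_mul (norm_nonneg x)]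
  simp only [hFp, hGq] at holder
  refine le_trans ?_ holder
  -- the pointwise comparison
  have hA0 : ∀ x ∉ tsupport f, ‖gradient f x‖ ^ p / ‖x‖ ^ γ = 0 := fun x hx ↦ by
    simp [hu0 x hx, Real.zero_rpow hp0.ne']
  have hAc : Continuous fun x ↦ ‖gradient f x‖ ^ p / ‖x‖ ^ γ :=
    continuous_of_eq_zero_off hS hA0 fun x hx ↦
      (hu.norm_rpow hp1).continuous.continuousAt.div (hw x hx γ) (hwne x hx γ)
  have hAint := hAc.integrable_of_hasCompactSupport (μ := volume) (hcs hA0)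
  have hFGint : Integrable (fun x ↦ F x * G x) := (hFc.mul hGc).integrable_of_hasCompactSupport
    (hcs fun x hx ↦ by simp [hF0 x hx])
  have hdiv0 : ∀ x ∉ tsupport f, vdiv (pohozaevField p γ f) x = 0 := fun x hx ↦
    vdiv_eq_zero_of_eq_zero_off hS hP0 hx
  have hdivint := (continuous_vdiv hP).integrable_of_hasCompactSupport (μ := volume) (hcs hdiv0)
  have hpt : ∀ x, (((n : ℝ) + γ * (p - 1) - p) / p) * (‖gradient f x‖ ^ p / ‖x‖ ^ γ) ≤
      F x * G x - vdiv (pohozaevField p γ f) x := fun x ↦ by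
    by_cases hx : x ∈ tsupport f
    swap
    · simp [hA0 x hx, hF0 x hx, hdiv0 x hx]
    have hxp : 0 < ‖x‖ := norm_pos_iff.2 (hne x hx)
    rw [vdiv_pohozaevField hp1 hf2 (hV.differentiable (by norm_num) x) (hne x hx)]
    have hFG : F x * G x =
        ‖x‖ ^ (-γ) * (‖x‖ * ‖gradient f x‖) * |pLaplacian p f x| := by
      have : ‖x‖ ^ (-γ) * ‖x‖ = (‖x‖ ^ α)⁻¹ * (‖x‖ ^ β)⁻¹ := by
        rw [← Real.rpow_add_one hxp.ne', ← Real.rpow_neg hxp.le, ← Real.rpow_neg hxp.le,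
          ← Real.rpow_add hxp]
        congr 1
        linarith
      rw [← mul_assoc, this]
      simp only [hF, hG]
      ring
    have hwx : 0 < ‖x‖ ^ (-γ) := Real.rpow_pos_of_pos hxp _
    have h₁ : ‖x‖ ^ (-γ) * ⟪x, gradient f x⟫ * pLaplacian p f x ≤ F x * G x := by
      rw [hFG, mul_assoc, mul_assoc]
      refine mul_le_mul_of_nonneg_left ?_ hwx.le
      refine (le_abs_self _).trans ?_
      rw [abs_mul]
      exact mul_le_mul_of_nonneg_right (abs_real_inner_le_norm _ _) (abs_nonneg _)
    have h₂ : ‖x‖ ^ (-γ - 2) * ‖gradient f x‖ ^ (p - 2) * ⟪x, gradient f x⟫ ^ 2 ≤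
        ‖gradient f x‖ ^ p * ‖x‖ ^ (-γ) := by
      have e₂ : ‖x‖ ^ (-γ) = ‖x‖ ^ (-γ - 2) * ‖x‖ ^ 2 := by
        rw [← Real.rpow_natCast, ← Real.rpow_add hxp]
        congr 1
        push_cast
        ring
      have h : ⟪x, gradient f x⟫ ^ 2 ≤ (‖x‖ * ‖gradient f x‖) ^ 2 := by
        rw [← sq_abs]
        gcongr
        exact abs_real_inner_le_norm _ _
      rw [Real.rpow_eq_rpow_sub_two_mul_sq (norm_nonneg (gradient f x)) hp0.ne', e₂]
      calc _ ≤ ‖x‖ ^ (-γ - 2) * ‖gradient f x‖ ^ (p - 2) * (‖x‖ * ‖gradient f x‖) ^ 2 := by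
            gcongr
        _ = _ := by ring
    have h₃ := mul_le_mul_of_nonneg_left h₂ (neg_nonneg.2 hγu)
    have h₄ : ‖gradient f x‖ ^ p / ‖x‖ ^ γ = ‖gradient f x‖ ^ p * ‖x‖ ^ (-γ) := by
      rw [Real.rpow_neg hxp.le, div_eq_mul_inv]
    have h₅ : ((n : ℝ) + γ * (p - 1) - p) / p = (n - γ - p) / p + γ := by
      field_simp
      ring
    rw [h₄, h₅]
    linarith
  have := integral_mono (hAint.const_mul _) (hFGint.sub hdivint) hpt
  rw [integral_const_mul, integral_sub' hFGint hdivint, hPint, sub_zero] at this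
  exact this
end
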